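/- Let E be a real inner product space, let n ≥ 2, and let L₁, …, Lₙ : E → ℝ be twice continuously differentiable losses, each with M-Lipschitz Hessian. Fix θ ∈ E and α > 0, and define H : E → ℝ by H(x) = (1/(n(n−1))) · Σ_{i ≠ j} ⟪∇L_i(x), ∇L_j(x)⟫ (the average gradient alignment over ordered pairs of distinct tasks). Then ‖ (1/(n(n−1))) · Σ_{i ≠ j} ∇L_i(θ − α·∇L_j(θ)) − (1/n) · Σ_i ∇L_i(θ) + (α/2)·∇H(θ) ‖ ≤ (M/2)·α² · (1/n) · Σ_j ‖∇L_j(θ)‖². In particular, averaged over ordered pairs of distinct tasks, taking one inner-loop gradient step on task j and then evaluating task i's gradient is, up to O(α²), gradient descent on the average loss plus ascent on the average pairwise gradient inner product. -/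

import Mathlib

open RealInnerProductSpace Finset

/-- The gradient of a `C²` function is continuously differentiable. -/
theorem ContDiff.gradient_one {E : Type*} [NormedAddCommGroup E] [InnerProductSpace ℝ E]
    [CompleteSpace E] {f : E → ℝ} (hf : ContDiff ℝ 2 f) : ContDiff ℝ 1 (gradient f) :=
  (InnerProductSpace.toDual ℝ E).symm.contDiff.comp (hf.fderiv_right (by norm_num))

/-- The derivative of the gradient of a `C²` function is a symmetric operator. -/
theorem ContDiff.inner_fderiv_gradient_comm {E : Type*} [NormedAddCommGroup E]
    [InnerProductSpace ℝ E] [CompleteSpace E] {f : E → ℝ} (hf : ContDiff ℝ 2 f) (x u v : E) :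
    ⟪fderiv ℝ (gradient f) x u, v⟫ = ⟪fderiv ℝ (gradient f) x v, u⟫ := by
  have hd : DifferentiableAt ℝ (gradient f) x :=
    hf.gradient_one.differentiable one_ne_zero x
  have key (u v : E) : ⟪fderiv ℝ (gradient f) x u, v⟫ = fderiv ℝ (fderiv ℝ f) x u v := by
    have h := ((InnerProductSpace.toDual ℝ E).toContinuousLinearEquiv.hasFDerivAt
      (x := gradient f x)).comp x hd.hasFDerivAt
    have h' : HasFDerivAt (fderiv ℝ f) _ x :=
      h.congr_of_eventuallyEq (.of_forall fun y => (toDual_gradient (f := f) (x := y)).symm)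
    rw [h'.fderiv]
    simp
  rw [key, key]
  exact hf.contDiffAt.isSymmSndFDerivAt (by simp) u v

/-- The gradient of the inner product of the gradients of two `C²` functions. -/
theorem ContDiff.hasGradientAt_inner_gradient {E : Type*} [NormedAddCommGroup E]
    [InnerProductSpace ℝ E] [CompleteSpace E] {f g : E → ℝ} (hf : ContDiff ℝ 2 f)
    (hg : ContDiff ℝ 2 g) (x : E) :
    HasGradientAt (fun y => ⟪gradient f y, gradient g y⟫)
      (fderiv ℝ (gradient f) x (gradient g x) + fderiv ℝ (gradient g) x (gradient f x)) x := by
  have hdf := (hf.gradient_one.differentiable one_ne_zero x).hasFDerivAt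
  have hdg := (hg.gradient_one.differentiable one_ne_zero x).hasFDerivAt
  rw [hasGradientAt_iff_hasFDerivAt]
  refine (hdf.inner ℝ hdg).congr_fderiv ?_
  ext v
  have h₁ := hf.inner_fderiv_gradient_comm x v (gradient g x)
  have h₂ := hg.inner_fderiv_gradient_comm x v (gradient f x)
  simp [← h₁, ← h₂, add_comm]

/-- Second-order Taylor bound for a map with Lipschitz derivative. -/
theorem norm_sub_sub_fderiv_le_of_lipschitz {E F : Type*} [NormedAddCommGroup E]
    [NormedSpace ℝ E] [NormedAddCommGroup F] [NormedSpace ℝ F] {f : E → F} {M : ℝ}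
    (hf : Differentiable ℝ f)
    (hM : ∀ x y, ‖fderiv ℝ f x - fderiv ℝ f y‖ ≤ M * ‖x - y‖) (x v : E) :
    ‖f (x + v) - f x - fderiv ℝ f x v‖ ≤ M / 2 * ‖v‖ ^ 2 := by
  have hφ (t : ℝ) : HasDerivAt (fun t : ℝ => f (x + t • v) - f x - t • fderiv ℝ f x v)
      ((fderiv ℝ f (x + t • v) - fderiv ℝ f x) v) t := by
    have hline : HasDerivAt (fun t : ℝ => x + t • v) v t := by
      simpa using ((hasDerivAt_id t).smul_const v).const_add x
    have hlin : HasDerivAt (fun t : ℝ => t • fderiv ℝ f x v) (fderiv ℝ f x v) t := by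
      simpa using (hasDerivAt_id t).smul_const (fderiv ℝ f x v)
    exact (((hf _).hasFDerivAt.comp_hasDerivAt t hline).sub_const (f x)).sub hlin
  have hB (t : ℝ) : HasDerivAt (fun t : ℝ => M / 2 * ‖v‖ ^ 2 * t ^ 2) (M * ‖v‖ ^ 2 * t) t := by
    refine ((hasDerivAt_pow 2 t).const_mul (M / 2 * ‖v‖ ^ 2)).congr_deriv ?_
    push_cast
    ring
  have h := image_norm_le_of_norm_deriv_right_le_deriv_boundary (a := 0) (b := 1)
    (fun t _ => (hφ t).continuousAt.continuousWithinAt) (fun t _ => (hφ t).hasDerivWithinAt)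
    (by simp) hB (fun t ht => by
      calc ‖(fderiv ℝ f (x + t • v) - fderiv ℝ f x) v‖
          ≤ ‖fderiv ℝ f (x + t • v) - fderiv ℝ f x‖ * ‖v‖ := ContinuousLinearMap.le_opNorm _ _
        _ ≤ M * ‖x + t • v - x‖ * ‖v‖ := by gcongr; exact hM _ _
        _ = M * ‖v‖ ^ 2 * t := by
          rw [add_sub_cancel_left, norm_smul, Real.norm_of_nonneg ht.1]; ring)
    (Set.right_mem_Icc.2 zero_le_one)
  simpa using h

theorem Finset.sum_offDiag_comm {ι A : Type*} [AddCommMonoid A] (s : Finset ι)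
    (f : ι → ι → A) : ∑ p ∈ s.offDiag, f p.2 p.1 = ∑ p ∈ s.offDiag, f p.1 p.2 :=
  Finset.sum_nbij' Prod.swap Prod.swap (by simp +contextual [eq_comm])
    (by simp +contextual [eq_comm]) (by simp) (by simp) (by simp)

theorem Finset.sum_offDiag_fst {ι V : Type*} [AddCommGroup V] [Module ℝ V]
    (s : Finset ι) (f : ι → V) :
    ∑ p ∈ s.offDiag, f p.1 = ((#s : ℝ) - 1) • ∑ i ∈ s, f i := by
  classical
  have h : ∑ p ∈ s.diag, f p.1 + ∑ p ∈ s.offDiag, f p.1 = ∑ p ∈ s ×ˢ s, f p.1 := by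
    rw [← Finset.sum_union (Finset.disjoint_diag_offDiag s), Finset.diag_union_offDiag]
  rw [Finset.sum_diag, Finset.sum_product] at h
  simp only [Finset.sum_const, ← Finset.smul_sum] at h
  rw [sub_smul, one_smul, Nat.cast_smul_eq_nsmul ℝ, ← h, add_sub_cancel_left]

/-- **finite-batch form of Theorem 1.** For `n ≥ 2` twice continuously
differentiable losses `L i : E → ℝ`, each with `M`-Lipschitz Hessian, let
`H x = (1/(n(n−1))) · Σ_{i ≠ j} ⟪∇L_i(x), ∇L_j(x)⟫` be the average gradient alignment
over ordered pairs of distinct tasks. Then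
`‖(1/(n(n−1)))·Σ_{i≠j} ∇L_i(θ − α·∇L_j(θ)) − (1/n)·Σ_i ∇L_i(θ) + (α/2)·∇H(θ)‖
  ≤ (M/2)·α²·(1/n)·Σ_j ‖∇L_j(θ)‖²`. -/
theorem batch_inner_loop_implicit_gradient_alignment
    {E : Type*} [NormedAddCommGroup E] [InnerProductSpace ℝ E] [CompleteSpace E]
    (n : ℕ) (hn : 2 ≤ n) (L : Fin n → E → ℝ) (M : ℝ)
    (hL : ∀ i, ContDiff ℝ 2 (L i))
    (hLip : ∀ i, ∀ x y : E,
      ‖fderiv ℝ (gradient (L i)) x - fderiv ℝ (gradient (L i)) y‖ ≤ M * ‖x - y‖)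
    (θ : E) (α : ℝ) (hα : 0 < α) :
    ‖(1 / ((n : ℝ) * ((n : ℝ) - 1))) •
          ∑ p ∈ (univ : Finset (Fin n)).offDiag,
            gradient (L p.1) (θ - α • gradient (L p.2) θ)
        - (1 / (n : ℝ)) • ∑ i, gradient (L i) θ
        + (α / 2) •
            gradient (fun x : E =>
              (1 / ((n : ℝ) * ((n : ℝ) - 1))) *
                ∑ p ∈ (univ : Finset (Fin n)).offDiag,
                  ⟪gradient (L p.1) x, gradient (L p.2) x⟫) θ‖
      ≤ (M / 2) * α ^ 2 * ((1 / (n : ℝ)) * ∑ j, ‖gradient (L j) θ‖ ^ 2) := by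
  set c : ℝ := 1 / ((n : ℝ) * ((n : ℝ) - 1)) with hc
  have hn' : (2 : ℝ) ≤ n := by exact_mod_cast hn
  have hn0 : (n : ℝ) ≠ 0 := by linarith
  have hn1 : (n : ℝ) - 1 ≠ 0 := by linarith
  have hc0 : 0 ≤ c := by
    have : 0 ≤ (n : ℝ) - 1 := by linarith
    positivity
  have hcn : c * ((n : ℝ) - 1) = 1 / n := by rw [hc]; field_simp
  have hH : gradient (fun x : E => c * ∑ p ∈ (univ : Finset (Fin n)).offDiag,
      ⟪gradient (L p.1) x, gradient (L p.2) x⟫) θ =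
      (2 * c) • ∑ p ∈ (univ : Finset (Fin n)).offDiag,
        fderiv ℝ (gradient (L p.1)) θ (gradient (L p.2) θ) := by
    refine HasGradientAt.gradient ?_
    rw [hasGradientAt_iff_hasFDerivAt]
    refine ((HasFDerivAt.fun_sum fun p _ =>
      ((hL p.1).hasGradientAt_inner_gradient (hL p.2) θ).hasFDerivAt).const_mul c).congr_fderiv ?_
    rw [← map_sum, Finset.sum_add_distrib, Finset.sum_offDiag_comm univ
      fun i j => fderiv ℝ (gradient (L i)) θ (gradient (L j) θ), ← two_smul ℝ, map_smulₛₗ,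
      map_smulₛₗ, smul_smul]
    simp [mul_comm]
  have hsum : (1 / (n : ℝ)) • ∑ i, gradient (L i) θ =
      c • ∑ p ∈ (univ : Finset (Fin n)).offDiag, gradient (L p.1) θ := by
    rw [Finset.sum_offDiag_fst univ fun i => gradient (L i) θ, smul_smul, card_univ,
      Fintype.card_fin, hcn]
  have hsq : ∑ p ∈ (univ : Finset (Fin n)).offDiag, ‖gradient (L p.2) θ‖ ^ 2 =
      ((n : ℝ) - 1) * ∑ j, ‖gradient (L j) θ‖ ^ 2 := by
    rw [Finset.sum_offDiag_comm univ fun i _ => ‖gradient (L i) θ‖ ^ 2,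
      Finset.sum_offDiag_fst univ fun i => ‖gradient (L i) θ‖ ^ 2, card_univ, Fintype.card_fin,
      smul_eq_mul]
  have hterm (p : Fin n × Fin n) :
      ‖gradient (L p.1) (θ - α • gradient (L p.2) θ) - gradient (L p.1) θ
        + α • fderiv ℝ (gradient (L p.1)) θ (gradient (L p.2) θ)‖
      ≤ M / 2 * α ^ 2 * ‖gradient (L p.2) θ‖ ^ 2 := by
    have h := norm_sub_sub_fderiv_le_of_lipschitz
      ((hL p.1).gradient_one.differentiable one_ne_zero) (hLip p.1) θ
      (-(α • gradient (L p.2) θ))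
    rw [map_neg, map_smul, sub_neg_eq_add, ← sub_eq_add_neg, norm_neg, norm_smul, mul_pow,
      Real.norm_eq_abs, sq_abs, ← mul_assoc] at h
    exact h
  rw [hH, hsum, smul_smul, show α / 2 * (2 * c) = c * α by ring, mul_smul, Finset.smul_sum (r := α),
    ← smul_sub, ← smul_add, ← Finset.sum_sub_distrib, ← Finset.sum_add_distrib, norm_smul,
    Real.norm_of_nonneg hc0]
  calc _ ≤ c * ∑ p ∈ (univ : Finset (Fin n)).offDiag,
        M / 2 * α ^ 2 * ‖gradient (L p.2) θ‖ ^ 2 := by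
        gcongr
        exact norm_sum_le_of_le _ fun p _ => hterm p
    _ = _ := by rw [← Finset.mul_sum, hsq, ← hcn]; ring
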